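/- arXiv:2104.06971 — 2 statements merged into one kernel-verified Lean document; each statement's English description precedes it below -/
import Mathlib

section
/- There exists an absolute constant c > 0 such that the following holds. Let ε > 0, C ≥ 1, and let G be a finite simple graph with n ≥ 1 vertices, average degree d = 2e(G)/n, maximum degree at most C·d, and with fewer than (1−ε) · (d/(6n)) · Σ_{u ∈ V(G)} d(u)² triangles (where d(u) is the degree of u). Then G has surplus at least c·(ε²/C)·d². -/
namespace MaxCutPaper

variable {V : Type*}

/-- The size of the cut induced by a vertex subset `S`: the number of edges of `G`
with one endpoint in `S` and the other outside `S` (counted via ordered pairs with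
first coordinate in `S`). -/
noncomputable def cutSize [Fintype V] (G : SimpleGraph V) (S : Finset V) : ℕ :=
  Nat.card {p : V × V // p.1 ∈ S ∧ p.2 ∉ S ∧ G.Adj p.1 p.2}

/-- The maximum size of a cut of `G`. -/
noncomputable def maxCut [Fintype V] (G : SimpleGraph V) : ℕ :=
  (Finset.univ : Finset V).powerset.sup (cutSize G)

/-- The number of edges of `G`. -/
noncomputable def edgeCount (G : SimpleGraph V) : ℕ := Nat.card G.edgeSet

/-- The surplus of `G`: `mc(G) - e(G)/2`. -/
noncomputable def surplus [Fintype V] (G : SimpleGraph V) : ℝ :=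
  (maxCut G : ℝ) - (edgeCount G : ℝ) / 2

/-- The degree of a vertex. -/
noncomputable def degC (G : SimpleGraph V) (v : V) : ℕ := Nat.card (G.neighborSet v)

/-- The number of copies of `K_r` in `G`, i.e. `r`-element sets of pairwise adjacent
vertices. -/
noncomputable def cliqueCount (G : SimpleGraph V) (r : ℕ) : ℕ :=
  Nat.card {s : Finset V // G.IsNClique r s}

/-- `G` contains no cycle of length `r`. -/
def CycleFree (G : SimpleGraph V) (r : ℕ) : Prop :=
  ∀ ⦃v : V⦄ (w : G.Walk v v), w.IsCycle → w.length ≠ r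

/-- `G` is `d`-degenerate (for a real `d ≥ 0`): every (induced) subgraph has a vertex of
degree at most `d`. -/
def Degenerate (G : SimpleGraph V) (d : ℝ) : Prop :=
  ∀ B : Finset V, B.Nonempty → ∃ v ∈ B, (Nat.card {u : V // u ∈ B ∧ G.Adj v u} : ℝ) ≤ d

/-- The number of edges of `G` with both endpoints in `T`. -/
noncomputable def edgesIn (G : SimpleGraph V) (T : Finset V) : ℝ :=
  (Nat.card {p : V × V // p.1 ∈ T ∧ p.2 ∈ T ∧ G.Adj p.1 p.2} : ℝ) / 2

open Classical in
/-- The real adjacency indicator of `G`. -/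
noncomputable def adjInd (G : SimpleGraph V) (u v : V) : ℝ := if G.Adj u v then 1 else 0

lemma adjInd_comm (G : SimpleGraph V) (u v : V) : adjInd G u v = adjInd G v u := by
  classical
  exact if_congr (G.adj_comm u v) rfl rfl

lemma adjInd_self (G : SimpleGraph V) (u : V) : adjInd G u u = 0 := by
  simp [adjInd]

lemma adjInd_nonneg (G : SimpleGraph V) (u v : V) : 0 ≤ adjInd G u v := by
  unfold adjInd; split_ifs <;> norm_num

lemma adjInd_le_one (G : SimpleGraph V) (u v : V) : adjInd G u v ≤ 1 := by
  unfold adjInd; split_ifs <;> norm_num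

lemma adjInd_sq (G : SimpleGraph V) (u v : V) : adjInd G u v ^ 2 = adjInd G u v := by
  unfold adjInd; split_ifs <;> norm_num

lemma degC_eq_sum [Fintype V] (G : SimpleGraph V) (u : V) :
    (degC G u : ℝ) = ∑ v, adjInd G u v := by
  classical
  simp [degC, adjInd, Finset.sum_boole, Nat.card_eq_fintype_card, Fintype.card_subtype,
    SimpleGraph.neighborSet]

lemma two_mul_edgeCount [Fintype V] (G : SimpleGraph V) :
    2 * (edgeCount G : ℝ) = ∑ u, (degC G u : ℝ) := by
  classical
  have h := G.sum_degrees_eq_twice_card_edges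
  have h1 : edgeCount G = G.edgeFinset.card := by
    rw [edgeCount, Nat.card_eq_fintype_card, SimpleGraph.edgeFinset_card]
  have h2 : ∀ u, degC G u = G.degree u := fun u => by
    rw [degC, Nat.card_eq_fintype_card, SimpleGraph.card_neighborSet_eq_degree]
  simp only [h1, h2]
  exact_mod_cast h.symm

lemma cutSize_eq_sum [Fintype V] [DecidableEq V] (G : SimpleGraph V) (S : Finset V) :
    (cutSize G S : ℝ) = ∑ u, ∑ v, if u ∈ S ∧ v ∉ S then adjInd G u v else 0 := by
  classical
  have h : ∀ u v : V, (if u ∈ S ∧ v ∉ S then adjInd G u v else 0) =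
      if u ∈ S ∧ v ∉ S ∧ G.Adj u v then (1 : ℝ) else 0 := by
    intro u v
    unfold adjInd
    split_ifs <;> tauto
  simp_rw [h]
  rw [← Fintype.sum_prod_type' (f := fun u v => if u ∈ S ∧ v ∉ S ∧ G.Adj u v then (1 : ℝ) else 0),
    Finset.sum_boole, cutSize, Nat.card_eq_fintype_card, Fintype.card_subtype]

lemma sum_adjInd_triangle_le [Fintype V] (G : SimpleGraph V) :
    ∑ w, ∑ u, ∑ v, adjInd G w u * adjInd G u v * adjInd G w v ≤ 6 * (cliqueCount G 3 : ℝ) := by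
  classical
  set T : Finset (V × V × V) :=
    Finset.univ.filter fun p => G.Adj p.1 p.2.1 ∧ G.Adj p.2.1 p.2.2 ∧ G.Adj p.1 p.2.2 with hT
  have h1 : ∑ w, ∑ u, ∑ v, adjInd G w u * adjInd G u v * adjInd G w v = (T.card : ℝ) := by
    rw [hT, ← Finset.sum_boole, Fintype.sum_prod_type]
    refine Finset.sum_congr rfl fun w _ => ?_
    rw [Fintype.sum_prod_type]
    refine Finset.sum_congr rfl fun u _ => Finset.sum_congr rfl fun v _ => ?_
    unfold adjInd
    split_ifs <;> simp_all
  have h2 : T.card ≤ 6 * (G.cliqueFinset 3).card := by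
    refine Finset.card_le_mul_card_image_of_maps_to (f := fun p => ({p.1, p.2.1, p.2.2} : Finset V))
      ?_ 6 ?_
    · rintro ⟨a, b, c⟩ hp
      simp only [hT, Finset.mem_filter, Finset.mem_univ, true_and] at hp
      simp only [SimpleGraph.mem_cliqueFinset_iff, SimpleGraph.is3Clique_triple_iff]
      tauto
    · intro s hs
      rw [SimpleGraph.mem_cliqueFinset_iff, SimpleGraph.is3Clique_iff] at hs
      obtain ⟨x, y, z, hxy, hxz, hyz, rfl⟩ := hs
      refine (Finset.card_le_card (t := {(x, y, z), (x, z, y), (y, x, z), (y, z, x), (z, x, y),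
        (z, y, x)}) ?_).trans Finset.card_le_six
      rintro ⟨a, b, c⟩ hp
      simp only [hT, Finset.mem_filter, Finset.mem_univ, true_and] at hp
      obtain ⟨⟨hab, hbc, hac⟩, he⟩ := hp
      have ha : a ∈ ({x, y, z} : Finset V) := he ▸ by simp
      have hb : b ∈ ({x, y, z} : Finset V) := he ▸ by simp
      have hc : c ∈ ({x, y, z} : Finset V) := he ▸ by simp
      have hab' := hab.ne
      have hbc' := hbc.ne
      have hac' := hac.ne
      simp only [Finset.mem_insert, Finset.mem_singleton, Prod.mk.injEq] at ha hb hc ⊢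
      clear he hab hbc hac hxy hxz hyz hT
      grind
  have h3 : cliqueCount G 3 = (G.cliqueFinset 3).card := by
    rw [cliqueCount, Nat.card_eq_fintype_card, Fintype.card_subtype]
    rfl
  rw [h1, h3]
  exact_mod_cast h2

lemma surplus_ge_of_sign [Fintype V] (G : SimpleGraph V) (x : V → ℝ)
    (hx : ∀ u, x u = 1 ∨ x u = -1) :
    -(∑ u, ∑ v, adjInd G u v * x u * x v) / 4 ≤ surplus G := by
  classical
  set S : Finset V := Finset.univ.filter fun u => x u = 1 with hS
  have hmax : (cutSize G S : ℝ) ≤ maxCut G := by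
    exact_mod_cast Finset.le_sup (f := cutSize G) (Finset.mem_powerset.2 (Finset.subset_univ S))
  have hc1 := cutSize_eq_sum G S
  have hc2 := hc1
  rw [Finset.sum_comm] at hc2
  have he := two_mul_edgeCount G
  simp_rw [degC_eq_sum] at he
  have key : ∑ u, ∑ v, adjInd G u v * x u * x v =
      2 * (edgeCount G : ℝ) - 2 * cutSize G S - 2 * cutSize G S := by
    nth_rewrite 1 [hc1]
    rw [hc2, he, Finset.mul_sum, Finset.mul_sum, ← Finset.sum_sub_distrib,
      ← Finset.sum_sub_distrib]
    refine Finset.sum_congr rfl fun u _ => ?_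
    rw [Finset.mul_sum, Finset.mul_sum, ← Finset.sum_sub_distrib, ← Finset.sum_sub_distrib]
    refine Finset.sum_congr rfl fun v _ => ?_
    rw [adjInd_comm G v u]
    rcases hx u with h | h <;> rcases hx v with h' | h' <;> simp [hS, h, h'] <;> norm_num <;> ring
  unfold surplus
  linarith

lemma exists_affine_update [Fintype V] [DecidableEq V] (G : SimpleGraph V) (x : V → ℝ) (w : V) :
    ∃ c k : ℝ, ∀ t : ℝ, ∑ u, ∑ v, adjInd G u v * Function.update x w t u *
      Function.update x w t v = c + k * t := by
  have h : ∀ u v, ∃ c k : ℝ, ∀ t : ℝ, adjInd G u v * Function.update x w t u *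
      Function.update x w t v = c + k * t := by
    intro u v
    by_cases hu : u = w <;> by_cases hv : v = w
    · exact ⟨0, 0, fun t => by simp [hu, hv, adjInd_self]⟩
    · exact ⟨0, adjInd G u v * x v, fun t => by simp [hu, hv]; ring⟩
    · exact ⟨0, adjInd G u v * x u, fun t => by simp [hu, hv]⟩
    · exact ⟨adjInd G u v * x u * x v, 0, fun t => by simp [hu, hv]⟩
  choose c k hck using h
  refine ⟨∑ u, ∑ v, c u v, ∑ u, ∑ v, k u v, fun t => ?_⟩
  simp_rw [hck, Finset.sum_add_distrib, Finset.sum_mul]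

lemma surplus_ge_of_abs_le_one [Fintype V] (G : SimpleGraph V) (x : V → ℝ)
    (hx : ∀ u, |x u| ≤ 1) :
    -(∑ u, ∑ v, adjInd G u v * x u * x v) / 4 ≤ surplus G := by
  classical
  suffices H : ∀ (T : Finset V) (x : V → ℝ), (∀ u, |x u| ≤ 1) →
      (∀ u, u ∉ T → x u = 1 ∨ x u = -1) →
      -(∑ u, ∑ v, adjInd G u v * x u * x v) / 4 ≤ surplus G from
    H Finset.univ x hx fun u hu => absurd (Finset.mem_univ u) hu
  intro T
  induction T using Finset.induction_on with
  | empty => exact fun x _ h => surplus_ge_of_sign G x fun u => h u (Finset.notMem_empty u)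
  | insert w T _ ih =>
    intro x hx hT
    obtain ⟨c, k, hck⟩ := exists_affine_update G x w
    have step : ∀ t : ℝ, t = 1 ∨ t = -1 → -(c + k * t) / 4 ≤ surplus G := by
      intro t ht
      rw [← hck t]
      refine ih _ (fun u => ?_) fun u hu => ?_
      · by_cases huw : u = w
        · rcases ht with rfl | rfl <;> simp [huw]
        · simpa [huw] using hx u
      · by_cases huw : u = w
        · simpa [huw] using ht
        · simpa [huw] using hT u (by simp [huw, hu])
    have h1 := step 1 (Or.inl rfl)
    have h2 := step (-1) (Or.inr rfl)
    have h0 := hck (x w)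
    rw [Function.update_eq_self] at h0
    rw [h0]
    have := abs_le.1 (hx w)
    nlinarith

/-- The sign `±1` attached to a Boolean. -/
def boolSign (b : Bool) : ℝ := if b then 1 else -1

lemma sum_cos_signed {W : Type*} [Fintype W] [DecidableEq W] (a : W → ℝ) :
    ∑ σ : W → Bool, Real.cos (∑ w, boolSign (σ w) * a w) =
      2 ^ Fintype.card W * ∏ w, Real.cos (a w) := by
  have h : ∑ σ : W → Bool, Complex.exp ((∑ w, boolSign (σ w) * a w : ℝ) * Complex.I) =
      ((2 ^ Fintype.card W * ∏ w, Real.cos (a w) : ℝ) : ℂ) := by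
    have h1 : ∀ σ : W → Bool, Complex.exp ((∑ w, boolSign (σ w) * a w : ℝ) * Complex.I) =
        ∏ w, Complex.exp ((boolSign (σ w) * a w : ℝ) * Complex.I) := by
      intro σ
      rw [← Complex.exp_sum, Complex.ofReal_sum, Finset.sum_mul]
    have h2 : ∀ w, ∑ b : Bool, Complex.exp ((boolSign b * a w : ℝ) * Complex.I) =
        2 * (Real.cos (a w) : ℂ) := by
      intro w
      rw [Complex.ofReal_cos, Complex.two_cos]
      simp [boolSign]
    simp_rw [h1]
    rw [← Fintype.prod_sum (f := fun w b => Complex.exp ((boolSign b * a w : ℝ) * Complex.I))]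
    simp_rw [h2, Finset.prod_mul_distrib]
    simp
  have h' := congrArg Complex.re h
  rw [Complex.re_sum, Complex.ofReal_re] at h'
  simpa only [Complex.exp_ofReal_mul_I_re] using h'

lemma abs_prod_sub_one_le {W : Type*} (T : Finset W) (z : W → ℝ) (hz : ∀ w, |z w| ≤ 1) :
    |∏ w ∈ T, z w| ≤ 1 ∧ |∏ w ∈ T, z w - 1| ≤ ∑ w ∈ T, |z w - 1| := by
  classical
  induction T using Finset.induction_on with
  | empty => simp
  | insert w T hw ih =>
    rw [Finset.prod_insert hw, Finset.sum_insert hw]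
    obtain ⟨h1, h2⟩ := ih
    refine ⟨by rw [abs_mul]; exact mul_le_one₀ (hz w) (abs_nonneg _) h1, ?_⟩
    have : z w * ∏ w ∈ T, z w - 1 = (z w - 1) * ∏ w ∈ T, z w + (∏ w ∈ T, z w - 1) := by ring
    rw [this]
    refine (abs_add_le _ _).trans (add_le_add ?_ h2)
    rw [abs_mul]
    exact mul_le_of_le_one_right (abs_nonneg _) h1

/-- A telescoping estimate for the difference of two products of numbers close to `1`. -/
lemma abs_prod_sub_prod_sub_sum_le {W : Type*} (T : Finset W) (z z' r : W → ℝ)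
    (hz : ∀ w, |z w| ≤ 1) (hz' : ∀ w, |z' w| ≤ 1)
    (hr : ∀ w, |z w - 1| ≤ r w) (hr' : ∀ w, |z' w - 1| ≤ r w) :
    |∏ w ∈ T, z w - ∏ w ∈ T, z' w| ≤ ∑ w ∈ T, |z w - z' w| ∧
    |∏ w ∈ T, z w - ∏ w ∈ T, z' w - ∑ w ∈ T, (z w - z' w)| ≤
      (∑ w ∈ T, r w) * ∑ w ∈ T, |z w - z' w| := by
  classical
  induction T using Finset.induction_on with
  | empty => simp
  | insert w T hw ih =>
    rw [Finset.prod_insert hw, Finset.prod_insert hw, Finset.sum_insert hw, Finset.sum_insert hw,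
      Finset.sum_insert hw]
    have h0 := (abs_prod_sub_one_le T z' hz').1
    have h1 := (abs_prod_sub_one_le T z' hz').2.trans (Finset.sum_le_sum fun w _ => hr' w)
    have hr0 : 0 ≤ r w := (abs_nonneg _).trans (hr w)
    obtain ⟨hD, hE⟩ := ih
    set P := ∏ w ∈ T, z w
    set P' := ∏ w ∈ T, z' w
    set D := ∑ w ∈ T, (z w - z' w)
    set E := ∑ w ∈ T, |z w - z' w|
    set R := ∑ w ∈ T, r w
    constructor
    · have : z w * P - z' w * P' = (z w - z' w) * P' + z w * (P - P') := by ring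
      rw [this]
      refine (abs_add_le _ _).trans (add_le_add ?_ ?_)
      · rw [abs_mul]
        exact mul_le_of_le_one_right (abs_nonneg _) h0
      · rw [abs_mul]
        exact (mul_le_of_le_one_left (abs_nonneg _) (hz w)).trans hD
    have : z w * P - z' w * P' - (z w - z' w + D) =
        (z w - 1) * (P - P') + (P - P' - D) + (z w - z' w) * (P' - 1) := by ring
    rw [this]
    have e1 : |(z w - 1) * (P - P')| ≤ r w * E := by
      rw [abs_mul]
      exact mul_le_mul (hr w) hD (abs_nonneg _) hr0
    have e2 : |(z w - z' w) * (P' - 1)| ≤ |z w - z' w| * R := by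
      rw [abs_mul]
      exact mul_le_mul_of_nonneg_left h1 (abs_nonneg _)
    have e3 := mul_nonneg hr0 (abs_nonneg (z w - z' w))
    calc _ ≤ r w * E + R * E + |z w - z' w| * R :=
          (abs_add_le _ _).trans (add_le_add ((abs_add_le _ _).trans (add_le_add e1 hE)) e2)
      _ ≤ _ := by nlinarith

lemma abs_cos_arcsin_add_sub_one_le {x y : ℝ} (hx : |x| ≤ 1) (hy : |y| ≤ 1) :
    |Real.cos (Real.arcsin x + Real.arcsin y) - 1| ≤ 3 / 2 * (x ^ 2 + y ^ 2) := by
  have hx' := abs_le.1 hx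
  have hy' := abs_le.1 hy
  have hsin : ∀ t : ℝ, |t| ≤ 1 → 1 - t ^ 2 ≤ Real.cos (Real.arcsin t) := by
    intro t ht
    have h1 : t ^ 2 ≤ 1 := (sq_le_one_iff_abs_le_one t).2 ht
    rw [Real.cos_arcsin]
    refine Real.le_sqrt_of_sq_le ?_
    nlinarith [sq_nonneg t]
  rw [abs_sub_comm, abs_of_nonneg (sub_nonneg.2 (Real.cos_le_one _)), Real.cos_add,
    Real.sin_arcsin hx'.1 hx'.2, Real.sin_arcsin hy'.1 hy'.2]
  have h1 : (1 - x ^ 2) * (1 - y ^ 2) ≤ Real.cos (Real.arcsin x) * Real.cos (Real.arcsin y) :=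
    mul_le_mul (hsin x hx) (hsin y hy)
      (sub_nonneg.2 ((sq_le_one_iff_abs_le_one y).2 hy)) (Real.cos_arcsin_nonneg x)
  nlinarith [sq_nonneg (x - y), sq_nonneg (x * y)]

lemma sum_sin_mul_sin_le {W : Type*} [Fintype W] [DecidableEq W] (x y : W → ℝ) {M : ℝ}
    (hx : ∀ w, |x w| ≤ 1) (hy : ∀ w, |y w| ≤ 1)
    (hxM : ∑ w, x w ^ 2 ≤ M) (hyM : ∑ w, y w ^ 2 ≤ M) :
    ∑ σ : W → Bool, Real.sin (∑ w, boolSign (σ w) * Real.arcsin (x w)) *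
        Real.sin (∑ w, boolSign (σ w) * Real.arcsin (y w)) ≤
      2 ^ Fintype.card W * (∑ w, x w * y w + 3 * M * ∑ w, |x w * y w|) := by
  have h1 : ∀ X Y : ℝ, Real.sin X * Real.sin Y = (Real.cos (X - Y) - Real.cos (X + Y)) / 2 := by
    intro X Y
    rw [Real.cos_sub, Real.cos_add]
    ring
  have h2 : ∑ σ : W → Bool, Real.sin (∑ w, boolSign (σ w) * Real.arcsin (x w)) *
        Real.sin (∑ w, boolSign (σ w) * Real.arcsin (y w)) =
      2 ^ Fintype.card W * ((∏ w, Real.cos (Real.arcsin (x w) - Real.arcsin (y w)) -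
        ∏ w, Real.cos (Real.arcsin (x w) + Real.arcsin (y w))) / 2) := by
    simp_rw [h1]
    rw [← Finset.sum_div, Finset.sum_sub_distrib, mul_div_assoc', mul_sub, ← sum_cos_signed,
      ← sum_cos_signed]
    simp_rw [mul_sub, mul_add, Finset.sum_sub_distrib, Finset.sum_add_distrib]
  rw [h2]
  refine mul_le_mul_of_nonneg_left ?_ (by positivity)
  have h3 := (abs_prod_sub_prod_sub_sum_le Finset.univ
    (fun w => Real.cos (Real.arcsin (x w) - Real.arcsin (y w)))
    (fun w => Real.cos (Real.arcsin (x w) + Real.arcsin (y w)))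
    (fun w => 3 / 2 * (x w ^ 2 + y w ^ 2))
    (fun w => Real.abs_cos_le_one _) (fun w => Real.abs_cos_le_one _)
    (fun w => by
      have := abs_cos_arcsin_add_sub_one_le (hx w) (y := -y w) (by rw [abs_neg]; exact hy w)
      rwa [Real.arcsin_neg, neg_sq, ← sub_eq_add_neg] at this)
    (fun w => abs_cos_arcsin_add_sub_one_le (hx w) (hy w))).2
  have h4 : ∀ w, Real.cos (Real.arcsin (x w) - Real.arcsin (y w)) -
      Real.cos (Real.arcsin (x w) + Real.arcsin (y w)) = 2 * (x w * y w) := by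
    intro w
    have hx' := abs_le.1 (hx w)
    have hy' := abs_le.1 (hy w)
    rw [Real.cos_sub, Real.cos_add, Real.sin_arcsin hx'.1 hx'.2, Real.sin_arcsin hy'.1 hy'.2]
    ring
  simp_rw [h4, abs_mul (2 : ℝ), abs_two] at h3
  rw [← Finset.mul_sum, ← Finset.mul_sum, ← Finset.mul_sum, Finset.sum_add_distrib] at h3
  have h5 := (abs_le.1 h3).2
  have h6 : 0 ≤ ∑ w, |x w * y w| := Finset.sum_nonneg fun w _ => abs_nonneg _
  nlinarith

lemma surplus_ge_of_vectors [Fintype V] {W : Type*} [Fintype W] (G : SimpleGraph V)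
    (y : W → V → ℝ) {M : ℝ} (hy : ∀ w u, |y w u| ≤ 1) (hM : ∀ u, ∑ w, y w u ^ 2 ≤ M) :
    -(∑ w, ∑ u, ∑ v, adjInd G u v * (y w u * y w v) +
      3 * M * ∑ w, ∑ u, ∑ v, adjInd G u v * |y w u * y w v|) / 4 ≤ surplus G := by
  classical
  set X : (W → Bool) → V → ℝ := fun σ u =>
    Real.sin (∑ w, boolSign (σ w) * Real.arcsin (y w u)) with hX
  have h1 : ∀ σ ∈ (Finset.univ : Finset (W → Bool)), -4 * surplus G ≤
      ∑ u, ∑ v, adjInd G u v * (X σ u * X σ v) := by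
    intro σ _
    have := surplus_ge_of_abs_le_one G (X σ) fun u => Real.abs_sin_le_one _
    simp_rw [mul_assoc] at this
    linarith
  have h2 := Finset.sum_le_sum h1
  have h3 : ∑ σ, ∑ u, ∑ v, adjInd G u v * (X σ u * X σ v) =
      ∑ u, ∑ v, adjInd G u v * ∑ σ, X σ u * X σ v := by
    rw [Finset.sum_comm]
    refine Finset.sum_congr rfl fun u _ => ?_
    rw [Finset.sum_comm]
    simp_rw [Finset.mul_sum]
  have h4 : ∑ u, ∑ v, adjInd G u v * ∑ σ, X σ u * X σ v ≤
      ∑ u, ∑ v, adjInd G u v * (2 ^ Fintype.card W *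
        (∑ w, y w u * y w v + 3 * M * ∑ w, |y w u * y w v|)) :=
    Finset.sum_le_sum fun u _ => Finset.sum_le_sum fun v _ => mul_le_mul_of_nonneg_left
      (sum_sin_mul_sin_le _ _ (fun w => hy w u) (fun w => hy w v) (hM u) (hM v))
      (adjInd_nonneg G u v)
  have hswap : ∀ f : W → V → V → ℝ, ∑ w, ∑ u, ∑ v, adjInd G u v * f w u v =
      ∑ u, ∑ v, adjInd G u v * ∑ w, f w u v := by
    intro f
    rw [Finset.sum_comm]
    refine Finset.sum_congr rfl fun u _ => ?_
    rw [Finset.sum_comm]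
    simp_rw [Finset.mul_sum]
  have h5 : ∑ u, ∑ v, adjInd G u v * (2 ^ Fintype.card W *
        (∑ w, y w u * y w v + 3 * M * ∑ w, |y w u * y w v|)) =
      2 ^ Fintype.card W * (∑ w, ∑ u, ∑ v, adjInd G u v * (y w u * y w v) +
      3 * M * ∑ w, ∑ u, ∑ v, adjInd G u v * |y w u * y w v|) := by
    rw [hswap, hswap]
    simp only [Finset.mul_sum, ← Finset.sum_add_distrib]
    refine Finset.sum_congr rfl fun u _ => Finset.sum_congr rfl fun v _ =>
      Finset.sum_congr rfl fun w _ => ?_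
    ring
  rw [h3] at h2
  have h6 := (h2.trans h4).trans_eq h5
  simp only [Finset.sum_const, Finset.card_univ, Fintype.card_fun, Fintype.card_bool,
    nsmul_eq_mul, Nat.cast_pow, Nat.cast_ofNat] at h6
  have h7 := le_of_mul_le_mul_left h6 (by positivity)
  linarith

/-- The quadratic form of `G`, summed over the neighbourhood indicator vectors shifted by `t`. -/
lemma sum_quadratic_shift [Fintype V] (G : SimpleGraph V) (t : ℝ) :
    ∑ w, ∑ u, ∑ v, adjInd G u v * ((adjInd G w u + t) * (adjInd G w v + t)) =
      ∑ w, ∑ u, ∑ v, adjInd G w u * adjInd G u v * adjInd G w v +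
        2 * t * ∑ u, (degC G u : ℝ) ^ 2 + t ^ 2 * (Fintype.card V * ∑ u, (degC G u : ℝ)) := by
  have h1 : ∑ w, ∑ u, ∑ v, adjInd G w u * adjInd G u v = ∑ u, (degC G u : ℝ) ^ 2 := by
    rw [Finset.sum_comm]
    refine Finset.sum_congr rfl fun u _ => ?_
    simp_rw [← Finset.mul_sum, ← degC_eq_sum, adjInd_comm G _ u]
    rw [← Finset.sum_mul, ← degC_eq_sum, sq]
  have h2 : ∑ w, ∑ u, ∑ v, adjInd G w v * adjInd G u v = ∑ u, (degC G u : ℝ) ^ 2 := by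
    rw [← h1]
    refine Finset.sum_congr rfl fun w _ => ?_
    rw [Finset.sum_comm]
    exact Finset.sum_congr rfl fun u _ => Finset.sum_congr rfl fun v _ => by
      rw [adjInd_comm G v u]
  have h3 : ∑ _w : V, ∑ u, ∑ v, adjInd G u v = Fintype.card V * ∑ u, (degC G u : ℝ) := by
    simp_rw [← degC_eq_sum]
    simp
  calc _ = ∑ w, ∑ u, ∑ v, (adjInd G w u * adjInd G u v * adjInd G w v +
        t * (adjInd G w u * adjInd G u v) + t * (adjInd G w v * adjInd G u v) +
        t ^ 2 * adjInd G u v) := by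
        refine Finset.sum_congr rfl fun w _ => Finset.sum_congr rfl fun u _ =>
          Finset.sum_congr rfl fun v _ => ?_
        ring
    _ = _ := by
        rw [two_mul t, add_mul]
        nth_rewrite 1 [← h1]
        rw [← h2, ← h3]
        simp only [Finset.sum_add_distrib, Finset.mul_sum]
        ring

/-- If `G` has `n ≥ 1` vertices, average degree `d`, maximum degree at most `C·d` and
fewer than `(1-ε)·(d/6n)·Σ_u d(u)²` triangles, then `sp(G) ≥ c·(ε²/C)·d²` for an
absolute constant `c > 0`. -/
theorem statement12 :
    ∃ c : ℝ, 0 < c ∧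
      ∀ (ε C : ℝ), 0 < ε → 1 ≤ C →
        ∀ (V : Type) [Fintype V] (G : SimpleGraph V) (d : ℝ),
          1 ≤ Fintype.card V →
          d = 2 * edgeCount G / Fintype.card V →
          (∀ v : V, (degC G v : ℝ) ≤ C * d) →
          (cliqueCount G 3 : ℝ) <
            (1 - ε) * (d / (6 * (Fintype.card V : ℝ))) * ∑ u : V, (degC G u : ℝ) ^ 2 →
          surplus G ≥ c * (ε ^ 2 / C) * d ^ 2 := by
  refine ⟨1 / 384, by norm_num, ?_⟩
  intro ε C hε hC V _ G d hn hd hmax htri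
  set n : ℝ := (Fintype.card V : ℝ) with hn_def
  set Q : ℝ := ∑ u : V, (degC G u : ℝ) ^ 2 with hQ
  have hn0 : 0 < n := by
    have : (1 : ℝ) ≤ n := by rw [hn_def]; exact_mod_cast hn
    linarith
  have hD : ∑ u, (degC G u : ℝ) = n * d := by
    rw [← two_mul_edgeCount, hd]
    field_simp
  have hdeg_nonneg : ∀ u, 0 ≤ (degC G u : ℝ) := fun u => Nat.cast_nonneg _
  have hdeg_le : ∀ u, (degC G u : ℝ) ≤ n := by
    intro u
    rw [degC_eq_sum]
    refine (Finset.sum_le_sum fun v _ => adjInd_le_one G u v).trans ?_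
    simp [hn_def]
  have hd0 : 0 ≤ d := by rw [hd]; positivity
  have hdn : d ≤ n := by
    have h := Finset.sum_le_sum fun u (_ : u ∈ Finset.univ) => hdeg_le u
    rw [hD, Finset.sum_const, Finset.card_univ, nsmul_eq_mul, ← hn_def] at h
    exact le_of_mul_le_mul_left h hn0
  have hQ0 : 0 ≤ Q := Finset.sum_nonneg fun u _ => sq_nonneg _
  have hQd : n * d ^ 2 ≤ Q := by
    have h := sq_sum_le_card_mul_sum_sq (s := Finset.univ) (f := fun u : V => (degC G u : ℝ))
    rw [hD, Finset.card_univ, ← hn_def, ← hQ] at h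
    refine le_of_mul_le_mul_left ?_ hn0
    linarith
  have hT := sum_adjInd_triangle_le G
  set T := ∑ w, ∑ u, ∑ v, adjInd G w u * adjInd G u v * adjInd G w v with hT_def
  set t : ℝ := d / n with ht
  have ht0 : 0 ≤ t := div_nonneg hd0 hn0.le
  have ht1 : t ≤ 1 := div_le_one_of_le₀ hdn hn0.le
  have htn : n * t = d := by rw [ht]; field_simp
  have hTlt : T < (1 - ε) * (t * Q) := by
    have h1 : 6 * ((1 - ε) * (d / (6 * n)) * Q) = (1 - ε) * (t * Q) := by
      rw [ht]; field_simp
    linarith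
  have hpos : 0 < (1 - ε) * (t * Q) := by
    refine lt_of_le_of_lt ?_ hTlt
    exact Finset.sum_nonneg fun w _ => Finset.sum_nonneg fun u _ => Finset.sum_nonneg fun v _ =>
      mul_nonneg (mul_nonneg (adjInd_nonneg _ _ _) (adjInd_nonneg _ _ _)) (adjInd_nonneg _ _ _)
  have htQ0 : 0 ≤ t * Q := mul_nonneg ht0 hQ0
  have hε1 : ε < 1 := by
    by_contra! h
    exact absurd hpos (not_lt.2 (mul_nonpos_of_nonpos_of_nonneg (by linarith) htQ0))
  have hdpos : 0 < d := by
    refine lt_of_le_of_ne hd0 fun h => ?_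
    rw [ht, ← h] at hpos
    simp at hpos
  have hCd : 1 ≤ C * d := by
    by_contra! h
    have h0 : ∀ u, (degC G u : ℝ) = 0 := by
      intro u
      have h1 : (degC G u : ℝ) < 1 := (hmax u).trans_lt h
      have h2 : degC G u < 1 := by exact_mod_cast h1
      have h3 : degC G u = 0 := by omega
      exact_mod_cast h3
    simp [hQ, h0] at hpos
  have htQ : d ^ 3 ≤ t * Q := by
    have h := mul_le_mul_of_nonneg_left hQd ht0
    have h1 : t * (n * d ^ 2) = d ^ 3 := by rw [← mul_assoc, mul_comm t n, htn]; ring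
    linarith
  have hd3 : t ^ 2 * (n * ∑ u, (degC G u : ℝ)) = d ^ 3 := by
    rw [hD, ht]; field_simp
  set s : ℝ := √(ε / (48 * (C * d))) with hs
  have hs0 : 0 ≤ s := Real.sqrt_nonneg _
  have hs2 : s ^ 2 = ε / (48 * (C * d)) := Real.sq_sqrt (by positivity)
  have hs1 : s ≤ 1 := by
    refine (Real.sqrt_le_iff).2 ⟨zero_le_one, ?_⟩
    rw [one_pow, div_le_one (by positivity)]
    linarith
  have hs2' : s ^ 2 * (48 * (C * d)) = ε := by
    rw [hs2]; field_simp
  set y : V → V → ℝ := fun w u => s * (adjInd G w u + -t) with hy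
  have hy1 : ∀ w u, |y w u| ≤ 1 := by
    intro w u
    rw [hy]
    simp only
    rw [abs_mul, abs_of_nonneg hs0]
    refine mul_le_one₀ hs1 (abs_nonneg _) (abs_le.2 ⟨?_, ?_⟩)
    · linarith [adjInd_nonneg G w u]
    · linarith [adjInd_le_one G w u]
  have hyM : ∀ u, ∑ w, y w u ^ 2 ≤ s ^ 2 * (2 * (C * d)) := by
    intro u
    have h1 : ∀ w, y w u ^ 2 ≤ s ^ 2 * (adjInd G u w + t ^ 2) := by
      intro w
      rw [hy]
      simp only
      rw [mul_pow, adjInd_comm G w u]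
      refine mul_le_mul_of_nonneg_left ?_ (sq_nonneg s)
      nlinarith [adjInd_sq G u w, mul_nonneg (adjInd_nonneg G u w) ht0]
    refine (Finset.sum_le_sum fun w _ => h1 w).trans ?_
    rw [← Finset.mul_sum, Finset.sum_add_distrib, ← degC_eq_sum, Finset.sum_const,
      Finset.card_univ, nsmul_eq_mul, ← hn_def]
    refine mul_le_mul_of_nonneg_left ?_ (sq_nonneg s)
    have h2 : n * t ^ 2 ≤ d := by
      rw [sq, ← mul_assoc, htn]
      exact mul_le_of_le_one_right hd0 ht1
    nlinarith [hmax u]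
  have hmain := surplus_ge_of_vectors G y hy1 hyM
  have hlin : ∑ w, ∑ u, ∑ v, adjInd G u v * (y w u * y w v) =
      s ^ 2 * (T + 2 * (-t) * Q + d ^ 3) := by
    rw [← hd3, ← neg_sq t, hn_def, hQ, hT_def, ← sum_quadratic_shift]
    simp only [Finset.mul_sum]
    refine Finset.sum_congr rfl fun w _ => Finset.sum_congr rfl fun u _ =>
      Finset.sum_congr rfl fun v _ => ?_
    rw [hy]
    ring
  have habs : ∑ w, ∑ u, ∑ v, adjInd G u v * |y w u * y w v| ≤
      s ^ 2 * (T + 2 * t * Q + d ^ 3) := by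
    rw [← hd3, hn_def, hQ, hT_def, ← sum_quadratic_shift]
    simp only [Finset.mul_sum]
    refine Finset.sum_le_sum fun w _ => Finset.sum_le_sum fun u _ =>
      Finset.sum_le_sum fun v _ => ?_
    have h1 : ∀ u, |y w u| ≤ s * (adjInd G w u + t) := by
      intro u
      rw [hy]
      simp only
      rw [abs_mul, abs_of_nonneg hs0]
      refine mul_le_mul_of_nonneg_left (abs_le.2 ⟨?_, ?_⟩) hs0
      · linarith [adjInd_nonneg G w u]
      · linarith [adjInd_le_one G w u]
    rw [abs_mul]
    have h2 := mul_le_mul (h1 u) (h1 v) (abs_nonneg _) ((abs_nonneg _).trans (h1 u))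
    have h3 := mul_le_mul_of_nonneg_left h2 (adjInd_nonneg G u v)
    linarith
  have habs' : ∑ w, ∑ u, ∑ v, adjInd G u v * |y w u * y w v| ≤ s ^ 2 * (4 * (t * Q)) := by
    refine habs.trans (mul_le_mul_of_nonneg_left ?_ (sq_nonneg s))
    nlinarith
  have hlin' : ∑ w, ∑ u, ∑ v, adjInd G u v * (y w u * y w v) ≤ s ^ 2 * (-ε * (t * Q)) := by
    rw [hlin]
    refine mul_le_mul_of_nonneg_left ?_ (sq_nonneg s)
    nlinarith
  have hM : 3 * (s ^ 2 * (2 * (C * d))) = ε / 8 := by linarith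
  rw [hM] at hmain
  have h1 : ε / 8 * ∑ w, ∑ u, ∑ v, adjInd G u v * |y w u * y w v| ≤
      ε / 8 * (s ^ 2 * (4 * (t * Q))) := mul_le_mul_of_nonneg_left habs' (by positivity)
  have h2 : s ^ 2 * ε * d ^ 3 ≤ s ^ 2 * ε * (t * Q) :=
    mul_le_mul_of_nonneg_left htQ (by positivity)
  have h3 : s ^ 2 * ε * d ^ 3 = ε ^ 2 / C * d ^ 2 / 48 := by
    rw [hs2]
    field_simp
  rw [ge_iff_le]
  linarith

end MaxCutPaper
end

section
/- For every integer r ≥ 3 there exists a constant c_r > 0 such that every finite simple graph with m edges that is d-degenerate (d ≥ 1) and contains no cycle of length r has surplus at least c_r · m / √d. -/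
namespace MaxCutPaper

variable {V : Type*}

section

open Finset

theorem exists_isPath_of_minDegree {V : Type*} [DecidableEq V] (G : SimpleGraph V) [DecidableRel G.Adj]
    (A : Finset V) (hA : A.Nonempty) (k : ℕ) (h : ∀ v ∈ A, k ≤ #{u ∈ A | G.Adj v u}) :
    ∀ l ≤ k, ∃ (u v : V) (w : G.Walk u v), w.IsPath ∧ w.length = l ∧ ∀ x ∈ w.support, x ∈ A := by
  intro l
  induction l with
  | zero =>
    intro _
    obtain ⟨a, ha⟩ := hA
    exact ⟨a, a, .nil, by simp, by simp, by simpa using ha⟩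
  | succ l ih =>
    intro hl
    obtain ⟨u, v, w, hw, hlen, hsup⟩ := ih (by omega)
    have hu : u ∈ A := hsup u w.start_mem_support
    obtain ⟨x, hx, hxw⟩ : ∃ x ∈ ({x ∈ A | G.Adj u x} : Finset V), x ∉ w.support.toFinset.erase u := by
      apply Finset.exists_mem_notMem_of_card_lt_card
      have h1 := List.toFinset_card_le w.support
      have h2 := Finset.card_erase_of_mem (s := w.support.toFinset) (a := u) (by simp)
      have h3 := h u hu
      rw [SimpleGraph.Walk.length_support] at h1
      omega
    rw [mem_filter] at hx
    have hxs : x ∉ w.support := by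
      intro hx'
      exact hxw (by simp [hx', hx.2.ne'])
    refine ⟨x, v, .cons hx.2.symm w, by simp [hw, hxs], by simp [hlen], ?_⟩
    intro y hy
    rw [SimpleGraph.Walk.support_cons, List.mem_cons] at hy
    rcases hy with rfl | hy
    · exact hx.1
    · exact hsup y hy

theorem CycleFree.exists_degree_le {V : Type*} [DecidableEq V] {G : SimpleGraph V}
    [DecidableRel G.Adj] {r : ℕ} (hr : 3 ≤ r) (hG : CycleFree G r) (k : V) (A : Finset V)
    (hA : A.Nonempty) (hk : ∀ v ∈ A, G.Adj k v) :
    ∃ v ∈ A, #{u ∈ A | G.Adj v u} ≤ r := by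
  by_contra! h
  obtain ⟨u, v, w, hw, hlen, hsup⟩ :=
    exists_isPath_of_minDegree G A hA r (fun v hv ↦ (h v hv).le) (r - 2) (by omega)
  have hks : k ∉ w.support := fun hk' ↦ G.irrefl (hk k (hsup k hk'))
  have huv : u ≠ v := by
    rintro rfl
    rw [SimpleGraph.Walk.isPath_iff_nil, ← SimpleGraph.Walk.length_eq_zero_iff] at hw
    omega
  have hcyc : (SimpleGraph.Walk.cons (hk v (hsup v w.end_mem_support)).symm
      (.cons (hk u (hsup u w.start_mem_support)) w)).IsCycle := by
    rw [SimpleGraph.Walk.cons_isCycle_iff]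
    refine ⟨by simp [hw, hks], ?_⟩
    rw [SimpleGraph.Walk.edges_cons, List.mem_cons, not_or]
    refine ⟨?_, fun he ↦ hks (w.snd_mem_support_of_mem_edges he)⟩
    rw [Sym2.eq_iff]
    rintro (⟨rfl, rfl⟩ | ⟨rfl, _⟩)
    · exact huv rfl
    · exact huv rfl
  refine hG _ hcyc ?_
  simp [hlen]
  omega

/-- An asymmetric subrelation of a relation for which every nonempty subset of `A` has an element
of degree at most `k` has at most `k * #A` pairs in `A`. -/
theorem sum_card_filter_le {V : Type*} [DecidableEq V] (R S : V → V → Prop) [DecidableRel R]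
    [DecidableRel S] (hSR : ∀ u v, S u v → R u v ∧ R v u) (hS : ∀ u v, S u v → ¬ S v u)
    (k : ℕ) (A : Finset V)
    (h : ∀ B ⊆ A, B.Nonempty → ∃ v ∈ B, #{u ∈ B | R v u} ≤ k) :
    ∑ i ∈ A, #{j ∈ A | S i j} ≤ k * #A := by
  induction A using Finset.strongInduction with
  | H A ih =>
    rcases A.eq_empty_or_nonempty with rfl | hA
    · simp
    obtain ⟨v, hv, hvk⟩ := h A subset_rfl hA
    have hsub : A.erase v ⊆ A := erase_subset v A
    have ih' := ih (A.erase v) (erase_ssubset hv) (fun B hB ↦ h B (hB.trans hsub))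
    have hvv : ¬ S v v := fun h ↦ hS v v h h
    have h1 : ∑ i ∈ A, #{j ∈ A | S i j} = #{j ∈ A | S v j} + (∑ i ∈ A.erase v,
        (#{j ∈ A.erase v | S i j} + if S i v then 1 else 0)) := by
      rw [← Finset.add_sum_erase A _ hv]
      congr 1
      refine sum_congr rfl fun i _ ↦ ?_
      simp only [card_filter]
      rw [← Finset.add_sum_erase A _ hv, add_comm]
    have h2 : #{j ∈ A | S v j} + ∑ i ∈ A.erase v, (if S i v then 1 else 0) ≤ #{u ∈ A | R v u} := by
      rw [← card_filter, ← card_union_of_disjoint]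
      · refine card_le_card fun x hx ↦ ?_
        simp only [mem_union, mem_filter, mem_erase] at hx ⊢
        rcases hx with hx | hx
        · exact ⟨hx.1, (hSR _ _ hx.2).1⟩
        · exact ⟨hx.1.2, (hSR _ _ hx.2).2⟩
      · refine Finset.disjoint_left.2 fun x hx hx' ↦ ?_
        exact hS _ _ (mem_filter.1 hx).2 (mem_filter.1 hx').2
    rw [h1, sum_add_distrib]
    have h3 := card_erase_add_one hv
    rw [← h3, mul_add]
    omega

/-- The vertices of a `d`-degenerate graph can be ranked so that each has at most `d` neighbours of
smaller rank. -/
theorem Degenerate.exists_rank {V : Type*} [DecidableEq V] {G : SimpleGraph V}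
    [DecidableRel G.Adj] {d : ℝ} (hG : Degenerate G d) (A : Finset V) :
    ∃ ρ : V → ℕ, Set.InjOn ρ A ∧ ∀ v ∈ A, (#{u ∈ A | G.Adj v u ∧ ρ u < ρ v} : ℝ) ≤ d := by
  induction A using Finset.strongInduction with
  | H A ih =>
    rcases A.eq_empty_or_nonempty with rfl | hA
    · simp
    obtain ⟨v, hv, hvd⟩ := hG A hA
    obtain ⟨ρ, hρ, hρd⟩ := ih (A.erase v) (erase_ssubset hv)
    have hlt : ∀ u ∈ A.erase v, ρ u < (A.erase v).sup ρ + 1 := fun u hu ↦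
      Nat.lt_succ_of_le (le_sup hu)
    set M := (A.erase v).sup ρ + 1
    have hne : ∀ u, u ≠ v → Function.update ρ v M u = ρ u := fun u hu ↦
      Function.update_of_ne hu _ _
    have heq : Function.update ρ v M v = M := Function.update_self _ _ _
    refine ⟨Function.update ρ v M, ?_, ?_⟩
    · intro a ha b hb hab
      by_cases hav : a = v <;> by_cases hbv : b = v
      · rw [hav, hbv]
      · subst hav
        rw [heq, hne b hbv] at hab
        exact absurd hab (hlt b (by simp_all)).ne'
      · subst hbv
        rw [heq, hne a hav] at hab
        exact absurd hab (hlt a (by simp_all)).ne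
      · rw [hne a hav, hne b hbv] at hab
        exact hρ (by simp_all) (by simp_all) hab
    · intro a ha
      by_cases hav : a = v
      · subst hav
        refine le_trans ?_ hvd
        rw [Nat.subtype_card ({u ∈ A | G.Adj a u}) (by simp)]
        exact_mod_cast card_le_card fun u hu ↦ by simp_all
      · refine le_trans ?_ (hρd a (by simp_all))
        have := hlt a (by simp_all)
        refine Nat.cast_le.2 (card_le_card fun u hu ↦ ?_)
        simp only [mem_filter, mem_erase] at hu ⊢
        rw [hne a hav] at hu
        have huv : u ≠ v := by
          rintro rfl
          rw [heq] at hu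
          omega
        rw [hne u huv] at hu
        tauto

/-- The vectors with all entries in `{1, -1}`. -/
noncomputable def signVectors (V : Type*) [Fintype V] [DecidableEq V] : Finset (V → ℝ) :=
  Fintype.piFinset fun _ ↦ {1, -1}

theorem mem_signVectors {V : Type*} [Fintype V] [DecidableEq V] {σ : V → ℝ} :
    σ ∈ signVectors V ↔ ∀ v, σ v = 1 ∨ σ v = -1 := by
  simp [signVectors]

theorem sum_signVectors_prod {V R : Type*} [Fintype V] [DecidableEq V] [CommRing R]
    (f : V → ℝ → R) :
    ∑ σ ∈ signVectors V, ∏ v, f v (σ v) = ∏ v, (f v 1 + f v (-1)) := by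
  rw [signVectors, ← Finset.prod_univ_sum]
  refine prod_congr rfl fun v _ ↦ ?_
  rw [sum_pair (by norm_num)]

theorem sum_cos_signVectors {V : Type*} [Fintype V] [DecidableEq V] (a : V → ℝ) :
    ∑ ε ∈ signVectors V, Real.cos (∑ v, a v * ε v) = 2 ^ Fintype.card V * ∏ v, Real.cos (a v) := by
  have h := sum_signVectors_prod (V := V) (fun v s ↦ Complex.exp ((a v * s : ℝ) * Complex.I))
  have h2 : ∀ v, Complex.exp ((a v * 1 : ℝ) * Complex.I) + Complex.exp ((a v * (-1) : ℝ) * Complex.I)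
      = ((2 * Real.cos (a v) : ℝ) : ℂ) := by
    intro v
    push_cast
    rw [Complex.two_cos]
    simp
  simp_rw [h2, ← Complex.exp_sum, ← Finset.sum_mul, ← Complex.ofReal_sum, ← Complex.ofReal_prod] at h
  have h3 := congrArg Complex.re h
  rw [Complex.re_sum, Complex.ofReal_re] at h3
  simp_rw [Complex.exp_ofReal_mul_I_re] at h3
  rw [h3, prod_mul_distrib]
  simp

theorem sum_sin_mul_sin_signVectors {V : Type*} [Fintype V] [DecidableEq V] (a b : V → ℝ) :
    ∑ ε ∈ signVectors V, Real.sin (∑ v, a v * ε v) * Real.sin (∑ v, b v * ε v) =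
      2 ^ Fintype.card V *
        ((∏ v, Real.cos (a v - b v) - ∏ v, Real.cos (a v + b v)) / 2) := by
  have h1 := sum_cos_signVectors (fun v ↦ a v - b v)
  have h2 := sum_cos_signVectors (fun v ↦ a v + b v)
  simp only [sub_mul, add_mul, sum_sub_distrib, sum_add_distrib] at h1 h2
  rw [mul_div_assoc', mul_sub, ← h1, ← h2, ← sum_sub_distrib, sum_div]
  refine sum_congr rfl fun ε _ ↦ ?_
  rw [Real.cos_sub, Real.cos_add]
  ring

/-- A quadratic form without diagonal terms that is at least `s` on sign vectors is at least `s`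
on the cube. -/
theorem le_sum_mul_of_forall_signVectors {V : Type*} [Fintype V] [DecidableEq V] (B : V → Finset V)
    (hB : ∀ i, i ∉ B i) (s : ℝ) (hs : ∀ σ ∈ signVectors V, s ≤ ∑ i, ∑ j ∈ B i, σ i * σ j)
    (p : V → ℝ) (hp : ∀ v, |p v| ≤ 1) : s ≤ ∑ i, ∑ j ∈ B i, p i * p j := by
  set w : (V → ℝ) → ℝ := fun σ ↦ ∏ v, ((1 + σ v * p v) / 2) with hw
  have hw1 : ∑ σ ∈ signVectors V, w σ = 1 := by
    have := sum_signVectors_prod (V := V) (fun v s ↦ (1 + s * p v) / 2)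
    rw [this]
    exact prod_eq_one fun v _ ↦ by ring
  have hw0 : ∀ σ ∈ signVectors V, 0 ≤ w σ := by
    intro σ hσ
    refine prod_nonneg fun v _ ↦ ?_
    have := abs_le.1 (hp v)
    rcases mem_signVectors.1 hσ v with h | h <;> rw [h] <;> linarith
  have hw2 : ∀ i j, i ≠ j → ∑ σ ∈ signVectors V, w σ * (σ i * σ j) = p i * p j := by
    intro i j hij
    have := sum_signVectors_prod (V := V)
      (fun v s ↦ (1 + s * p v) / 2 * ((if v = i then s else 1) * (if v = j then s else 1)))
    simp only [prod_mul_distrib, prod_ite_eq', mem_univ, if_true] at this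
    rw [hw, this]
    have hprod : p i * p j = ∏ v, ((if v = i then p v else 1) * (if v = j then p v else 1)) := by
      simp only [prod_mul_distrib, prod_ite_eq', mem_univ, if_true]
    rw [hprod]
    refine prod_congr rfl fun v _ ↦ ?_
    by_cases h1 : v = i <;> by_cases h2 : v = j
    · exact absurd (h1.symm.trans h2) hij
    all_goals simp [h1, h2, hij, hij.symm]; ring
  calc s = ∑ σ ∈ signVectors V, w σ * s := by rw [← sum_mul, hw1, one_mul]
    _ ≤ ∑ σ ∈ signVectors V, w σ * ∑ i, ∑ j ∈ B i, σ i * σ j :=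
        sum_le_sum fun σ hσ ↦ mul_le_mul_of_nonneg_left (hs σ hσ) (hw0 σ hσ)
    _ = ∑ i, ∑ j ∈ B i, ∑ σ ∈ signVectors V, w σ * (σ i * σ j) := by
        simp_rw [mul_sum]
        rw [sum_comm]
        exact sum_congr rfl fun i _ ↦ sum_comm
    _ = ∑ i, ∑ j ∈ B i, p i * p j :=
        sum_congr rfl fun i _ ↦ sum_congr rfl fun j hj ↦
          hw2 i j (by rintro rfl; exact hB _ hj)

theorem prod_sub_prod_le_sum {ι : Type*} (s : Finset ι) (x y : ι → ℝ)
    (hx : ∀ i ∈ s, |x i| ≤ 1) (hy : ∀ i ∈ s, |y i| ≤ 1) :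
    |∏ i ∈ s, x i - ∏ i ∈ s, y i| ≤ ∑ i ∈ s, |x i - y i| := by
  classical
  induction s using Finset.induction_on with
  | empty => simp
  | insert a s ha ih =>
    rw [prod_insert ha, prod_insert ha, sum_insert ha]
    have ih' := ih (fun i hi ↦ hx i (mem_insert_of_mem hi)) (fun i hi ↦ hy i (mem_insert_of_mem hi))
    have h1 : |∏ i ∈ s, x i| ≤ 1 := by
      rw [abs_prod]
      exact prod_le_one (fun _ _ ↦ abs_nonneg _) (fun i hi ↦ hx i (mem_insert_of_mem hi))
    have h2 := hy a (mem_insert_self a s)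
    calc |x a * ∏ i ∈ s, x i - y a * ∏ i ∈ s, y i|
        = |(x a - y a) * ∏ i ∈ s, x i + y a * (∏ i ∈ s, x i - ∏ i ∈ s, y i)| := by ring_nf
      _ ≤ |x a - y a| * |∏ i ∈ s, x i| + |y a| * |∏ i ∈ s, x i - ∏ i ∈ s, y i| := by
          rw [← abs_mul, ← abs_mul]; exact abs_add_le _ _
      _ ≤ _ := by
          gcongr
          · exact mul_le_of_le_one_right (abs_nonneg _) h1
          · exact (mul_le_of_le_one_left (abs_nonneg _) h2).trans ih'

/-- The neighbours of `v` of smaller rank. -/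
noncomputable def backNeighbors {V : Type*} [Fintype V] (G : SimpleGraph V) (ρ : V → ℕ) (v : V) :
    Finset V :=
  open Classical in {u | G.Adj v u ∧ ρ u < ρ v}

theorem mem_backNeighbors {V : Type*} [Fintype V] {G : SimpleGraph V} {ρ : V → ℕ} {v u : V} :
    u ∈ backNeighbors G ρ v ↔ G.Adj v u ∧ ρ u < ρ v := by
  simp [backNeighbors]

theorem sum_adj_eq_sum_backNeighbors {V : Type*} [Fintype V] (G : SimpleGraph V)
    [DecidableRel G.Adj] {ρ : V → ℕ} (hρ : ρ.Injective) (f : V → V → ℝ) :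
    ∑ i, ∑ j with G.Adj i j, f i j = ∑ i, ∑ j ∈ backNeighbors G ρ i, (f i j + f j i) := by
  classical
  have h : ∀ i, ∑ j with G.Adj i j, f i j =
      ∑ j ∈ backNeighbors G ρ i, f i j + ∑ j with G.Adj i j ∧ ρ i < ρ j, f i j := by
    intro i
    rw [← sum_union]
    · refine sum_congr ?_ fun _ _ ↦ rfl
      ext j
      simp only [mem_filter, mem_univ, true_and, mem_union, mem_backNeighbors, ← and_or_left]
      refine ⟨fun hij ↦ ⟨hij, ?_⟩, And.left⟩
      exact lt_or_gt_of_ne (hρ.ne hij.ne')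
    · refine disjoint_left.2 fun j hj hj' ↦ ?_
      exact lt_asymm (mem_backNeighbors.1 hj).2 (mem_filter.1 hj').2.2
  simp_rw [h, sum_add_distrib]
  congr 1
  refine sum_comm' fun i j ↦ ?_
  simp [mem_backNeighbors, G.adj_comm]

theorem edgeCount_eq_sum_card_backNeighbors {V : Type*} [Fintype V] (G : SimpleGraph V)
    {ρ : V → ℕ} (hρ : ρ.Injective) :
    (edgeCount G : ℝ) = ∑ i, (#(backNeighbors G ρ i) : ℝ) := by
  classical
  have h := sum_adj_eq_sum_backNeighbors G hρ fun _ _ ↦ 1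
  have h2 := G.sum_degrees_eq_twice_card_edges
  have h3 : edgeCount G = #G.edgeFinset := by
    rw [edgeCount, Nat.card_eq_fintype_card, SimpleGraph.edgeFinset_card]
  simp only [sum_const, nsmul_eq_mul, mul_one, ← sum_mul] at h
  have h4 : ∑ i, (#{j | G.Adj i j} : ℝ) = 2 * edgeCount G := by
    rw [h3]
    simp only [← SimpleGraph.neighborFinset_eq_filter, SimpleGraph.card_neighborFinset_eq_degree]
    exact_mod_cast h2
  linarith

theorem surplus_ge_of_mem_signVectors {V : Type*} [Fintype V] [DecidableEq V] (G : SimpleGraph V)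
    {ρ : V → ℕ} (hρ : ρ.Injective) {σ : V → ℝ} (hσ : σ ∈ signVectors V) :
    -2 * surplus G ≤ ∑ i, ∑ j ∈ backNeighbors G ρ i, σ i * σ j := by
  classical
  set S : Finset V := {v | σ v = 1} with hS
  have hmem : ∀ v, v ∈ S ↔ σ v = 1 := by simp [hS]
  have h1 : cutSize G S ≤ maxCut G := le_sup (f := cutSize G) (by simp)
  have h2 : (cutSize G S : ℝ) = ∑ i, ∑ j with G.Adj i j, if i ∈ S ∧ j ∉ S then 1 else 0 := by
    rw [cutSize, Nat.subtype_card
      ({p : V × V | p.1 ∈ S ∧ p.2 ∉ S ∧ G.Adj p.1 p.2} : Finset (V × V)) (by simp), card_filter,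
      ← univ_product_univ, sum_product]
    push_cast
    refine sum_congr rfl fun i _ ↦ ?_
    rw [sum_filter]
    refine sum_congr rfl fun j _ ↦ ?_
    split_ifs <;> tauto
  rw [sum_adj_eq_sum_backNeighbors G hρ] at h2
  have h3 : ∀ i j, ((if i ∈ S ∧ j ∉ S then 1 else 0) + (if j ∈ S ∧ i ∉ S then 1 else 0) : ℝ) =
      1 / 2 - σ i * σ j / 2 := by
    intro i j
    simp only [hmem]
    rcases mem_signVectors.1 hσ i with hi | hi <;> rcases mem_signVectors.1 hσ j with hj | hj <;>
      rw [hi, hj] <;> norm_num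
  simp_rw [h3, sum_sub_distrib, ← sum_div] at h2
  have h4 := edgeCount_eq_sum_card_backNeighbors G hρ
  simp only [sum_const, nsmul_eq_mul, ← sum_mul, ← h4] at h2
  have h5 : (cutSize G S : ℝ) ≤ maxCut G := by exact_mod_cast h1
  rw [surplus]
  linarith

theorem sum_card_inter_backNeighbors_le {V : Type*} [Fintype V] [DecidableEq V] {G : SimpleGraph V}
    {ρ : V → ℕ} {r : ℕ} (hr : 3 ≤ r) (hG : CycleFree G r) :
    ∑ i, ∑ j ∈ backNeighbors G ρ i, #(backNeighbors G ρ i ∩ backNeighbors G ρ j) ≤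
      r * ∑ i, #(backNeighbors G ρ i) := by
  classical
  set N : V → Finset V := fun k ↦ {i | k ∈ backNeighbors G ρ i} with hN
  have hmem : ∀ i k, i ∈ N k ↔ k ∈ backNeighbors G ρ i := by simp [hN]
  have h1 : ∑ i, #(backNeighbors G ρ i) = ∑ k, #(N k) := by
    simp_rw [card_eq_sum_ones]
    exact sum_comm' fun i k ↦ by simp [hmem]
  have h2 : ∑ i, ∑ j ∈ backNeighbors G ρ i, #(backNeighbors G ρ i ∩ backNeighbors G ρ j) =
      ∑ k, ∑ i ∈ N k, #{j ∈ N k | j ∈ backNeighbors G ρ i} := by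
    have h3 : ∀ i, ∑ j ∈ backNeighbors G ρ i, #(backNeighbors G ρ i ∩ backNeighbors G ρ j) =
        ∑ k ∈ backNeighbors G ρ i, #{j ∈ N k | j ∈ backNeighbors G ρ i} := by
      intro i
      simp_rw [card_eq_sum_ones]
      refine sum_comm' fun j k ↦ ?_
      simp only [mem_inter, mem_filter, hmem]
      tauto
    simp_rw [h3]
    exact sum_comm' fun i k ↦ by simp [hmem]
  rw [h1, h2, mul_sum]
  refine sum_le_sum fun k _ ↦ ?_
  refine sum_card_filter_le G.Adj (fun i j ↦ j ∈ backNeighbors G ρ i) ?_ ?_ r (N k) ?_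
  · intro u v h
    exact ⟨(mem_backNeighbors.1 h).1, (mem_backNeighbors.1 h).1.symm⟩
  · intro u v h h'
    exact lt_asymm (mem_backNeighbors.1 h).2 (mem_backNeighbors.1 h').2
  · intro A hA hA'
    exact hG.exists_degree_le hr k A hA' fun v hv ↦
      (mem_backNeighbors.1 ((hmem v k).1 (hA hv))).1.symm

theorem prod_cos_sub_sub_prod_cos_add_le {V : Type*} [Fintype V] [DecidableEq V]
    (A B : Finset V) (θ : ℝ) :
    ∏ v, Real.cos ((if v ∈ A then θ else 0) - (if v ∈ B then θ else 0)) -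
      ∏ v, Real.cos ((if v ∈ A then θ else 0) + (if v ∈ B then θ else 0)) ≤
      2 * θ ^ 2 * #(A ∩ B) := by
  refine (le_abs_self _).trans ((prod_sub_prod_le_sum _ _ _ (fun _ _ ↦ Real.abs_cos_le_one _)
    (fun _ _ ↦ Real.abs_cos_le_one _)).trans ?_)
  have h : ∀ v, |Real.cos ((if v ∈ A then θ else 0) - (if v ∈ B then θ else 0)) -
      Real.cos ((if v ∈ A then θ else 0) + (if v ∈ B then θ else 0))| ≤
      if v ∈ A ∩ B then 2 * θ ^ 2 else 0 := by
    intro v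
    by_cases hA : v ∈ A <;> by_cases hB : v ∈ B <;> simp [hA, hB]
    have h1 := Real.cos_le_one (θ + θ)
    have h2 := Real.one_sub_sq_div_two_le_cos (x := θ + θ)
    rw [abs_le]
    constructor <;> nlinarith
  refine (sum_le_sum fun v _ ↦ h v).trans (le_of_eq ?_)
  rw [← sum_filter, filter_mem_eq_inter, univ_inter, sum_const, nsmul_eq_mul, mul_comm]

theorem prod_cos_single_sub {V : Type*} [Fintype V] [DecidableEq V] (A : Finset V) (j : V)
    (θ : ℝ) :
    ∏ v, Real.cos ((if v = j then Real.pi / 2 else 0) - (if v ∈ A then θ else 0)) =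
      if j ∈ A then Real.sin θ * Real.cos θ ^ (#A - 1) else 0 := by
  split_ifs with hj
  · have h : ∀ v, Real.cos ((if v = j then Real.pi / 2 else 0) - (if v ∈ A then θ else 0)) =
        (if v = j then Real.sin θ else 1) * (if v ∈ A.erase j then Real.cos θ else 1) := by
      intro v
      by_cases h1 : v = j <;> by_cases h2 : v ∈ A <;>
        simp_all [Real.cos_pi_div_two_sub]
    simp_rw [h]
    rw [prod_mul_distrib, prod_ite_eq', if_pos (mem_univ j), prod_ite_mem, univ_inter, prod_const,
      card_erase_of_mem hj]
  · exact prod_eq_zero (mem_univ j) (by simp [hj])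

theorem sum_sin_single_mul_sin {V : Type*} [Fintype V] [DecidableEq V] (A : Finset V) (j : V)
    (θ : ℝ) :
    ∑ ε ∈ signVectors V, Real.sin (∑ v, (if v = j then Real.pi / 2 else 0) * ε v) *
        Real.sin (∑ v, (if v ∈ A then θ else 0) * ε v) =
      2 ^ Fintype.card V * if j ∈ A then Real.sin θ * Real.cos θ ^ (#A - 1) else 0 := by
  have h1 := prod_cos_single_sub A j θ
  have h2 := prod_cos_single_sub A j (-θ)
  have h3 : ∀ v, (if v = j then Real.pi / 2 else 0) - (if v ∈ A then -θ else 0) =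
      (if v = j then Real.pi / 2 else 0) + (if v ∈ A then θ else 0) := by
    intro v
    by_cases h : v ∈ A <;> simp [h]
  simp_rw [h3] at h2
  rw [sum_sin_mul_sin_signVectors, h1, h2, Real.sin_neg, Real.cos_neg]
  split_ifs <;> ring

theorem sum_sin_mul_sin_le_s13 {V : Type*} [Fintype V] [DecidableEq V] (A B : Finset V) (θ : ℝ) :
    ∑ ε ∈ signVectors V, Real.sin (∑ v, (if v ∈ A then θ else 0) * ε v) *
        Real.sin (∑ v, (if v ∈ B then θ else 0) * ε v) ≤
      2 ^ Fintype.card V * (θ ^ 2 * #(A ∩ B)) := by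
  rw [sum_sin_mul_sin_signVectors]
  gcongr
  linarith [prod_cos_sub_sub_prod_cos_add_le A B θ]

/-- The fractional cut: each vertex is assigned half its own sign, minus a damped function of the
signs of its back-neighbours. -/
noncomputable def fractionalCut {V : Type*} [Fintype V] [DecidableEq V] (G : SimpleGraph V)
    (ρ : V → ℕ) (γ θ : ℝ) (ε : V → ℝ) (i : V) : ℝ :=
  (Real.sin (∑ v, (if v = i then Real.pi / 2 else 0) * ε v) -
    γ * Real.sin (∑ v, (if v ∈ backNeighbors G ρ i then θ else 0) * ε v)) / 2

theorem abs_fractionalCut_le {V : Type*} [Fintype V] [DecidableEq V] (G : SimpleGraph V)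
    (ρ : V → ℕ) {γ : ℝ} (hγ : 0 ≤ γ) (hγ1 : γ ≤ 1) (θ : ℝ) (ε : V → ℝ) (i : V) :
    |fractionalCut G ρ γ θ ε i| ≤ 1 := by
  rw [fractionalCut]
  set x := Real.sin (∑ v, (if v = i then Real.pi / 2 else 0) * ε v) with hx
  set y := Real.sin (∑ v, (if v ∈ backNeighbors G ρ i then θ else 0) * ε v) with hy
  have hx1 : -1 ≤ x := Real.neg_one_le_sin _
  have hx2 : x ≤ 1 := Real.sin_le_one _
  have hy1 : -1 ≤ y := Real.neg_one_le_sin _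
  have hy2 : y ≤ 1 := Real.sin_le_one _
  rw [abs_le]
  constructor <;> nlinarith

theorem sum_fractionalCut_mul_le {V : Type*} [Fintype V] [DecidableEq V] (G : SimpleGraph V)
    (ρ : V → ℕ) (γ θ : ℝ) {i j : V} (hij : j ∈ backNeighbors G ρ i) :
    ∑ ε ∈ signVectors V, fractionalCut G ρ γ θ ε i * fractionalCut G ρ γ θ ε j ≤
      2 ^ Fintype.card V *
        ((γ ^ 2 * (θ ^ 2 * #(backNeighbors G ρ i ∩ backNeighbors G ρ j)) -
          γ * (Real.sin θ * Real.cos θ ^ (#(backNeighbors G ρ i) - 1))) / 4) := by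
  obtain ⟨hadj, hlt⟩ := mem_backNeighbors.1 hij
  have h1 := sum_sin_single_mul_sin {j} i (Real.pi / 2)
  have h2 := sum_sin_single_mul_sin (backNeighbors G ρ j) i θ
  have h3 := sum_sin_single_mul_sin (backNeighbors G ρ i) j θ
  have h4 := sum_sin_mul_sin_le_s13 (backNeighbors G ρ i) (backNeighbors G ρ j) θ
  rw [if_neg (by simpa using hadj.ne)] at h1
  rw [if_neg (fun h ↦ lt_asymm hlt (mem_backNeighbors.1 h).2)] at h2
  rw [if_pos hij] at h3
  simp only [mem_singleton] at h1
  have h5 := mul_le_mul_of_nonneg_left h4 (sq_nonneg γ)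
  have hexpand : ∀ a b a' b' : ℝ, (a - γ * b) / 2 * ((a' - γ * b') / 2) =
      (1 / 4) * (a * a') - (γ / 4) * (a * b') - (γ / 4) * (a' * b) + (γ ^ 2 / 4) * (b * b') := by
    intros; ring
  simp_rw [fractionalCut, hexpand]
  simp only [sum_add_distrib, sum_sub_distrib, ← mul_sum]
  rw [h1, h2, h3]
  linarith

theorem quarter_le_sin_mul_cos_pow {d : ℝ} (hd : 1 ≤ d) {b : ℕ} (hb : (b : ℝ) ≤ d) :
    1 / √d / 4 ≤ Real.sin (1 / √d) * Real.cos (1 / √d) ^ (b - 1) := by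
  have hs : 1 ≤ √d := Real.one_le_sqrt.2 hd
  set θ := 1 / √d with hθ
  have hθ0 : 0 < θ := by positivity
  have hθ1 : θ ≤ 1 := by rw [hθ, div_le_one (by positivity)]; exact hs
  have hθd : θ ^ 2 * d = 1 := by
    rw [hθ, div_pow, Real.sq_sqrt (by linarith)]
    field_simp
  have hsin : θ / 2 ≤ Real.sin θ := by
    have := Real.sin_gt_sub_cube hθ0
    nlinarith [mul_pos hθ0 hθ0]
  have hcos : 1 / 2 ≤ Real.cos θ ^ (b - 1) := by
    have h1 := Real.one_sub_sq_div_two_le_cos (x := θ)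
    have h2 : (1 : ℝ) + ((b - 1 : ℕ) : ℝ) * (-(θ ^ 2 / 2)) ≤ (1 + -(θ ^ 2 / 2)) ^ (b - 1) :=
      one_add_mul_le_pow (by nlinarith) _
    have h3 : ((b - 1 : ℕ) : ℝ) ≤ d := (Nat.cast_le.2 (Nat.sub_le b 1)).trans hb
    have h4 : (1 + -(θ ^ 2 / 2)) ^ (b - 1) ≤ Real.cos θ ^ (b - 1) :=
      pow_le_pow_left₀ (by nlinarith) (by linarith) _
    nlinarith [mul_le_mul_of_nonneg_left h3 (sq_nonneg θ)]
  nlinarith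

theorem surplus_ge_of_backNeighbors {V : Type*} [Fintype V] [DecidableEq V] (G : SimpleGraph V)
    {ρ : V → ℕ} (hρ : ρ.Injective) {d : ℝ} (hd : 1 ≤ d)
    (hρd : ∀ v, (#(backNeighbors G ρ v) : ℝ) ≤ d) {γ : ℝ} (hγ : 0 ≤ γ) (hγ1 : γ ≤ 1) :
    (γ / 4 * edgeCount G - γ ^ 2 * ∑ i, ∑ j ∈ backNeighbors G ρ i,
      (#(backNeighbors G ρ i ∩ backNeighbors G ρ j) : ℝ)) / (8 * √d) ≤ surplus G := by
  have hs : 1 ≤ √d := Real.one_le_sqrt.2 hd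
  set θ := 1 / √d with hθ
  have hθ0 : 0 < θ := by positivity
  have hθ1 : θ ≤ 1 := by rw [hθ, div_le_one (by positivity)]; exact hs
  have h1 : ∀ ε ∈ signVectors V, -2 * surplus G ≤ ∑ i, ∑ j ∈ backNeighbors G ρ i,
      fractionalCut G ρ γ θ ε i * fractionalCut G ρ γ θ ε j := fun ε _ ↦
    le_sum_mul_of_forall_signVectors (backNeighbors G ρ)
      (fun i hi ↦ G.irrefl (mem_backNeighbors.1 hi).1) _
      (fun σ hσ ↦ surplus_ge_of_mem_signVectors G hρ hσ) _ (abs_fractionalCut_le G ρ hγ hγ1 θ ε)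
  have hcard : (#(signVectors V) : ℝ) = 2 ^ Fintype.card V := by
    simpa using sum_cos_signVectors (V := V) 0
  have h2 := sum_le_sum h1
  rw [sum_const, nsmul_eq_mul, hcard, sum_comm] at h2
  have h3 : ∀ i, ∑ ε ∈ signVectors V, ∑ j ∈ backNeighbors G ρ i,
      fractionalCut G ρ γ θ ε i * fractionalCut G ρ γ θ ε j ≤
      ∑ j ∈ backNeighbors G ρ i, 2 ^ Fintype.card V *
        ((γ ^ 2 * #(backNeighbors G ρ i ∩ backNeighbors G ρ j) - γ / 4) * (θ / 4)) := by
    intro i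
    rw [sum_comm]
    refine sum_le_sum fun j hj ↦ (sum_fractionalCut_mul_le G ρ γ θ hj).trans ?_
    gcongr
    have h4 := mul_le_mul_of_nonneg_left (quarter_le_sin_mul_cos_pow hd (hρd i)) hγ
    rw [← hθ] at h4
    have h5 : γ ^ 2 * (θ ^ 2 * (#(backNeighbors G ρ i ∩ backNeighbors G ρ j) : ℝ)) ≤
        γ ^ 2 * (θ * #(backNeighbors G ρ i ∩ backNeighbors G ρ j)) := by
      gcongr
      nlinarith
    linarith
  have h6 := h2.trans (sum_le_sum fun i _ ↦ h3 i)
  simp_rw [← mul_sum] at h6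
  have h7 := le_of_mul_le_mul_left h6 (by positivity)
  simp_rw [← sum_mul, sum_sub_distrib, sum_const, nsmul_eq_mul, ← sum_mul, ← mul_sum] at h7
  rw [← edgeCount_eq_sum_card_backNeighbors G hρ] at h7
  have h8 : ∀ x : ℝ, x / (8 * √d) = x * (θ / 8) := by
    intro x
    rw [hθ]
    field_simp
  rw [h8]
  linarith

end

/-- For every `r ≥ 3` there is `c_r > 0` such that every `d`-degenerate (`d ≥ 1`)
graph with `m` edges containing no cycle of length `r` has surplus at least
`c_r · m / √d`. -/
theorem statement13 (r : ℕ) (hr : 3 ≤ r) :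
    ∃ c : ℝ, 0 < c ∧
      ∀ (V : Type) [Fintype V] (G : SimpleGraph V) (d : ℝ),
        1 ≤ d → CycleFree G r → Degenerate G d →
        surplus G ≥ c * edgeCount G / Real.sqrt d := by
  have hr0 : (3 : ℝ) ≤ r := by exact_mod_cast hr
  refine ⟨1 / (512 * r), by positivity, fun V _ G d hd hC hD ↦ ?_⟩
  classical
  obtain ⟨ρ, hρ, hρd⟩ := hD.exists_rank Finset.univ
  have hρ' : ρ.Injective := by simpa [Set.injOn_univ] using hρ
  have hB : ∀ v, ((backNeighbors G ρ v).card : ℝ) ≤ d := fun v ↦ by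
    convert hρd v (Finset.mem_univ v) using 3
    ext u
    simp [mem_backNeighbors]
  have hs := surplus_ge_of_backNeighbors G hρ' hd hB (γ := 1 / (8 * r)) (by positivity)
    (by rw [div_le_one (by positivity)]; linarith)
  have hT : (∑ i, ∑ j ∈ backNeighbors G ρ i,
      ((backNeighbors G ρ i ∩ backNeighbors G ρ j).card : ℝ)) ≤ r * edgeCount G := by
    rw [edgeCount_eq_sum_card_backNeighbors G hρ']
    exact_mod_cast sum_card_inter_backNeighbors_le (ρ := ρ) hr hC
  refine le_trans ?_ hs
  have hsqrt : 0 < √d := Real.sqrt_pos.2 (by linarith)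
  calc 1 / (512 * r) * edgeCount G / √d
      = (1 / (8 * r) / 4 * edgeCount G - (1 / (8 * r)) ^ 2 * (r * edgeCount G)) / (8 * √d) := by
        field_simp
        ring
    _ ≤ _ := by gcongr

end MaxCutPaper
end
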